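/- Let L be a first-order language having only relation symbols and let X be an L-structure with domain ℕ. Then the sets χ[P(X)] and χ[P(X)↑] have the Baire property in the Cantor space 2^ℕ, and each of the cardinalities |P(X)| and |P(X)↑| equals 1, ℵ₀, or 2^{ℵ₀}. -/

import Mathlib

open FirstOrder

/-- For a relational language, every subset of an `L`-structure carries the induced structure. -/
instance setStructure (L : FirstOrder.Language) [L.IsRelational] {M : Type*} [L.Structure M]
    (s : Set M) : L.Structure s where
  funMap f _ := isEmptyElim f
  RelMap r x := Language.Structure.RelMap r (fun i => (x i : M))

/-- `Copies L M` is the family of domains of substructures of `M` isomorphic to `M`. -/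
def Copies (L : FirstOrder.Language) [L.IsRelational] (M : Type*) [L.Structure M] :
    Set (Set M) :=
  {A : Set M | Nonempty (L.Equiv A M)}

/-- The identification of a subset of `ℕ` with its characteristic function, an element of the
Cantor space `2^ℕ`. -/
noncomputable def chi (A : Set ℕ) : ℕ → Bool :=
  fun n => @decide (n ∈ A) (Classical.dec _)

/-- The points near which a set is nowhere meagre. -/
def nonMeagrePoints {α : Type*} [TopologicalSpace α] (A : Set α) : Set α :=
  {x | ∀ U ∈ nhds x, ¬ IsMeagre (A ∩ U)}

section NonMeagrePoints

open Set Filter Topology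

variable {α : Type*} [TopologicalSpace α]

theorem isClosed_nonMeagrePoints (A : Set α) : IsClosed (nonMeagrePoints A) := by
  rw [← isOpen_compl_iff, isOpen_iff_mem_nhds]
  intro x hx
  simp only [nonMeagrePoints, mem_compl_iff, mem_ofPred_eq, not_forall, not_not] at hx
  obtain ⟨U, hU, hm⟩ := hx
  filter_upwards [eventually_mem_nhds_iff.2 hU] with y hy hyA
  exact hyA U hy hm

theorem nonMeagrePoints_subset_closure (A : Set α) : nonMeagrePoints A ⊆ closure A := by
  intro x hx
  rw [mem_closure_iff_nhds]
  intro U hU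
  rw [inter_comm]
  exact nonempty_of_not_isMeagre (hx U hU)

theorem isMeagre_diff_nonMeagrePoints [SecondCountableTopology α] (A : Set α) :
    IsMeagre (A \ nonMeagrePoints A) := by
  have hB := TopologicalSpace.isBasis_countableBasis α
  have key : A \ nonMeagrePoints A ⊆
      ⋃ U ∈ {U ∈ TopologicalSpace.countableBasis α | IsMeagre (A ∩ U)}, A ∩ U := by
    rintro x ⟨hxA, hx⟩
    simp only [nonMeagrePoints, mem_ofPred_eq, not_forall, not_not] at hx
    obtain ⟨U, hU, hm⟩ := hx
    obtain ⟨V, hV, hxV, hVU⟩ := hB.mem_nhds_iff.1 hU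
    exact mem_biUnion (x := V) ⟨hV, hm.mono (inter_subset_inter_right _ hVU)⟩ ⟨hxA, hxV⟩
  refine IsMeagre.mono key (isMeagre_biUnion ?_ fun U hU => hU.2)
  exact (TopologicalSpace.countable_countableBasis α).mono fun _ h => h.1

theorem IsClosed.isMeagre_diff_interior {D : Set α} (hD : IsClosed D) :
    IsMeagre (D \ interior D) := by
  rw [← hD.frontier_eq]
  refine IsNowhereDense.isMeagre ?_
  rw [IsNowhereDense, isClosed_frontier.closure_eq, interior_frontier hD]

theorem IsOpen.isMeagre_closure_diff {W : Set α} (hW : IsOpen W) : IsMeagre (closure W \ W) := by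
  rw [← hW.frontier_eq]
  refine IsNowhereDense.isMeagre ?_
  rw [IsNowhereDense, isClosed_frontier.closure_eq, ← frontier_compl,
    interior_frontier hW.isClosed_compl]

theorem isMeagre_nonMeagrePoints_diff_iUnion [SecondCountableTopology α] {ι : Type*} [Countable ι]
    {A : Set α} {B : ι → Set α} (h : A ⊆ ⋃ i, B i) :
    IsMeagre (nonMeagrePoints A \ ⋃ i, nonMeagrePoints (B i)) := by
  set W : Set α := ⋃ i, interior (nonMeagrePoints (B i)) with hW
  have hWo : IsOpen W := isOpen_iUnion fun _ => isOpen_interior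
  have hsub : nonMeagrePoints A ⊆ closure W := by
    intro x hx
    by_contra hxW
    refine hx _ (isClosed_closure.isOpen_compl.mem_nhds hxW) ?_
    refine IsMeagre.mono ?_ (isMeagre_iUnion fun i =>
      (isMeagre_diff_nonMeagrePoints (B i)).union
        (isClosed_nonMeagrePoints (B i)).isMeagre_diff_interior)
    rintro y ⟨hyA, hyW⟩
    obtain ⟨i, hi⟩ := mem_iUnion.1 (h hyA)
    refine mem_iUnion.2 ⟨i, ?_⟩
    by_cases hy : y ∈ nonMeagrePoints (B i)
    · exact Or.inr ⟨hy, fun hy' => hyW (subset_closure (mem_iUnion.2 ⟨i, hy'⟩))⟩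
    · exact Or.inl ⟨hi, hy⟩
  refine hWo.isMeagre_closure_diff.mono ?_
  rintro x ⟨hx, hx'⟩
  exact ⟨hsub hx, fun hxW => hx' (iUnion_mono (fun _ => interior_subset) hxW)⟩

end NonMeagrePoints

section AnalyticSet

open Set Filter Topology MeasureTheory PiNat

theorem eq_of_forall_mem_closure_image_cylinder {α : Type*} [TopologicalSpace α] [T2Space α]
    {g : (ℕ → ℕ) → α} (hg : Continuous g) {x : α} {y : ℕ → ℕ}
    (h : ∀ n, x ∈ closure (g '' cylinder y n)) : g y = x := by
  by_contra hne
  obtain ⟨V, W, hV, hW, hyV, hxW, hVW⟩ := t2_separation hne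
  obtain ⟨_, ⟨z, n, rfl⟩, hy, hsub⟩ :=
    (isTopologicalBasis_cylinders (fun _ : ℕ => ℕ)).mem_nhds_iff.1
      (hg.continuousAt.preimage_mem_nhds (hV.mem_nhds hyV))
  rw [mem_cylinder_iff_eq] at hy
  rw [← hy] at hsub
  obtain ⟨_, hw, w, hw', rfl⟩ := mem_closure_iff.1 (h n) W hW hxW
  exact hVW.ne_of_mem (hsub hw') hw rfl

/-- Lusin–Sierpiński: analytic sets have the Baire property. -/
theorem MeasureTheory.AnalyticSet.exists_isOpen_isMeagre_symmDiff {α : Type*} [TopologicalSpace α]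
    [T2Space α] [SecondCountableTopology α] {s : Set α} (hs : AnalyticSet s) :
    ∃ U : Set α, IsOpen U ∧ IsMeagre (symmDiff U s) := by
  rw [AnalyticSet] at hs
  rcases hs with rfl | ⟨g, hg, rfl⟩
  · exact ⟨∅, isOpen_empty, by simpa using IsMeagre.empty⟩
  let A : List ℕ → Set α := fun l => g '' {y | res y l.length = l}
  have hA : ∀ l, A l ⊆ ⋃ n, A (n :: l) := by
    rintro l _ ⟨y, hy, rfl⟩
    refine mem_iUnion.2 ⟨y l.length, y, ?_, rfl⟩
    simp only [mem_ofPred_eq] at hy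
    simp [hy]
  have hnil : A [] = range g := by simp [A]
  set D := nonMeagrePoints (range g) with hD
  have hM : IsMeagre (⋃ l, nonMeagrePoints (A l) \ ⋃ n, nonMeagrePoints (A (n :: l))) :=
    isMeagre_iUnion fun l => isMeagre_nonMeagrePoints_diff_iUnion (hA l)
  have hDg : D \ range g ⊆ ⋃ l, nonMeagrePoints (A l) \ ⋃ n, nonMeagrePoints (A (n :: l)) := by
    rintro x ⟨hxD, hxg⟩
    by_contra hx
    simp only [mem_iUnion, Set.mem_sdiff, not_exists, not_and, not_forall, not_not] at hx
    choose! a ha using hx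
    let L : ℕ → List ℕ := fun n => Nat.rec [] (fun _ l => a l :: l) n
    have hL : ∀ n, x ∈ nonMeagrePoints (A (L n)) := by
      intro n
      induction n with
      | zero => simpa [L, hnil] using hxD
      | succ n ih => exact ha _ ih
    have hres : ∀ n, res (fun k => a (L k)) n = L n := by
      intro n
      induction n with
      | zero => rfl
      | succ n ih => rw [res_succ, ih]
    refine hxg ⟨fun k => a (L k), eq_of_forall_mem_closure_image_cylinder hg fun n => ?_⟩
    have := nonMeagrePoints_subset_closure _ (hL n)
    rw [cylinder_eq_res, hres]
    have hlen : (L n).length = n := by rw [← hres, res_length]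
    simpa only [A, hlen] using this
  refine ⟨interior D, isOpen_interior, IsMeagre.mono ?_
    ((hM.mono hDg).union ((isMeagre_diff_nonMeagrePoints (range g)).union
      (isClosed_nonMeagrePoints (range g)).isMeagre_diff_interior))⟩
  rintro x (⟨hx, hx'⟩ | ⟨hx, hx'⟩)
  · exact Or.inl ⟨interior_subset hx, hx'⟩
  · by_cases hxD : x ∈ D
    · exact Or.inr (Or.inr ⟨hxD, hx'⟩)
    · exact Or.inr (Or.inl ⟨hx, hxD⟩)

end AnalyticSet

section PerfectSet

open Set Filter Topology Metric Function CantorScheme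
open scoped ENNReal

theorem exists_pair_not_countable_image_inter_nhds {α β : Type*} [TopologicalSpace α]
    [SecondCountableTopology α] {g : α → β} {C : Set α} (hC : ¬ (g '' C).Countable) :
    ∃ x₀ ∈ C, ∃ x₁ ∈ C, g x₀ ≠ g x₁ ∧ (∀ V ∈ 𝓝 x₀, ¬ (g '' (V ∩ C)).Countable) ∧
      ∀ V ∈ 𝓝 x₁, ¬ (g '' (V ∩ C)).Countable := by
  set S : Set α := {x ∈ C | ∀ V ∈ 𝓝 x, ¬ (g '' (V ∩ C)).Countable} with hS
  have hB := TopologicalSpace.isBasis_countableBasis α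
  have hsmall : (⋃ V ∈ {V ∈ TopologicalSpace.countableBasis α | (g '' (V ∩ C)).Countable},
      g '' (V ∩ C)).Countable :=
    ((TopologicalSpace.countable_countableBasis α).mono fun _ h => h.1).biUnion fun _ h => h.2
  have hnt : (g '' S).Nontrivial := by
    rw [← not_subsingleton_iff]
    intro hss
    refine hC ((hsmall.union hss.countable).mono ?_)
    rintro _ ⟨x, hx, rfl⟩
    by_cases hxS : x ∈ S
    · exact Or.inr (mem_image_of_mem g hxS)
    · left
      simp only [hS, mem_ofPred_eq, not_and, not_forall, not_not] at hxS
      obtain ⟨U, hU, hUc⟩ := hxS hx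
      obtain ⟨V, hV, hxV, hVU⟩ := hB.mem_nhds_iff.1 hU
      exact mem_biUnion (x := V) ⟨hV, hUc.mono (image_mono (inter_subset_inter_left _ hVU))⟩
        ⟨x, ⟨hxV, hx⟩, rfl⟩
  obtain ⟨_, ⟨x₀, hx₀, rfl⟩, _, ⟨x₁, hx₁, rfl⟩, hne⟩ := hnt
  exact ⟨x₀, hx₀.1, x₁, hx₁.1, hne, hx₀.2, hx₁.2⟩

theorem exists_isClosed_splitting_of_not_countable_image {α β : Type*} [MetricSpace α]
    [SecondCountableTopology α] [TopologicalSpace β] [T2Space β] {g : α → β} (hg : Continuous g)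
    {C : Set α} (hCc : IsClosed C) (hC : ¬ (g '' C).Countable) {ε : ℝ≥0∞} (hε : 0 < ε) :
    ∃ C₀ C₁ : Set α, (IsClosed C₀ ∧ ¬ (g '' C₀).Countable ∧ C₀ ⊆ C ∧ Metric.ediam C₀ ≤ ε) ∧
      (IsClosed C₁ ∧ ¬ (g '' C₁).Countable ∧ C₁ ⊆ C ∧ Metric.ediam C₁ ≤ ε) ∧
      Disjoint (g '' C₀) (g '' C₁) := by
  obtain ⟨x₀, -, x₁, -, hne, h₀, h₁⟩ := exists_pair_not_countable_image_inter_nhds hC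
  obtain ⟨U₀, U₁, hU₀, hU₁, hx₀, hx₁, hU⟩ := t2_separation hne
  have piece : ∀ (x : α) (U : Set β), IsOpen U → g x ∈ U →
      ∃ V ∈ 𝓝 x, IsClosed V ∧ V ⊆ g ⁻¹' U ∧ Metric.ediam V ≤ ε := by
    intro x U hUo hx
    have hmem : g ⁻¹' U ∩ Metric.eball x (ε / 2) ∈ 𝓝 x :=
      inter_mem (hg.continuousAt.preimage_mem_nhds (hUo.mem_nhds hx))
        (Metric.eball_mem_nhds x (ENNReal.half_pos hε.ne'))
    obtain ⟨V, hV, hVc, hVU⟩ := exists_mem_nhds_isClosed_subset hmem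
    refine ⟨V, hV, hVc, hVU.trans inter_subset_left,
      (Metric.ediam_mono (hVU.trans inter_subset_right)).trans ?_⟩
    refine Metric.ediam_eball_le.trans ?_
    rw [mul_comm, ENNReal.div_mul_cancel] <;> norm_num
  obtain ⟨V₀, hV₀, hc₀, hs₀, hd₀⟩ := piece x₀ U₀ hU₀ hx₀
  obtain ⟨V₁, hV₁, hc₁, hs₁, hd₁⟩ := piece x₁ U₁ hU₁ hx₁
  refine ⟨V₀ ∩ C, V₁ ∩ C,
    ⟨hc₀.inter hCc, h₀ V₀ hV₀, inter_subset_right, (ediam_mono inter_subset_left).trans hd₀⟩,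
    ⟨hc₁.inter hCc, h₁ V₁ hV₁, inter_subset_right, (ediam_mono inter_subset_left).trans hd₁⟩,
    hU.mono ?_ ?_⟩
  · exact image_subset_iff.2 (inter_subset_left.trans hs₀)
  · exact image_subset_iff.2 (inter_subset_left.trans hs₁)

theorem exists_nat_bool_injection_range_of_not_countable {α β : Type*} [MetricSpace α]
    [CompleteSpace α] [SecondCountableTopology α] [TopologicalSpace β] [T2Space β] {g : α → β}
    (hg : Continuous g) (hunc : ¬ (range g).Countable) :
    ∃ f : (ℕ → Bool) → β, range f ⊆ range g ∧ Injective f := by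
  obtain ⟨u, -, upos', hu⟩ := exists_seq_strictAnti_tendsto' (zero_lt_one' ℝ≥0∞)
  have upos := fun n => (upos' n).1
  let P := {C : Set α // IsClosed C ∧ ¬ (g '' C).Countable}
  have hsplit : ∀ (C : P) (n : ℕ), ∃ C' : Bool → P,
      (∀ b, (C' b).1 ⊆ C.1 ∧ Metric.ediam (C' b).1 ≤ u n) ∧
      Pairwise fun a b => Disjoint (g '' (C' a).1) (g '' (C' b).1) := by
    rintro ⟨C, hCc, hC⟩ n
    obtain ⟨C₀, C₁, ⟨a₀, b₀, c₀, d₀⟩, ⟨a₁, b₁, c₁, d₁⟩, hd⟩ :=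
      exists_isClosed_splitting_of_not_countable_image hg hCc hC (upos n)
    refine ⟨fun b => bif b then ⟨C₁, a₁, b₁⟩ else ⟨C₀, a₀, b₀⟩, ?_, ?_⟩
    · rintro (_ | _)
      exacts [⟨c₀, d₀⟩, ⟨c₁, d₁⟩]
    · rintro (_ | _) (_ | _) hab <;> try contradiction
      exacts [hd, hd.symm]
  choose next hnext hdisj using hsplit
  let DP : List Bool → P := fun l =>
    List.rec ⟨univ, isClosed_univ, by rwa [image_univ]⟩ (fun a l C => next C (l.length + 1) a) l
  let D : List Bool → Set α := fun l => (DP l).1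
  have hanti : ClosureAntitone D := by
    refine Antitone.closureAntitone ?_ fun l => (DP l).2.1
    exact fun l a => (hnext (DP l) (l.length + 1) a).1
  have hdiam : VanishingDiam D := by
    intro x
    refine tendsto_of_tendsto_of_tendsto_of_le_of_le' tendsto_const_nhds hu (by simp) ?_
    filter_upwards [eventually_ge_atTop 1] with m hm
    obtain ⟨n, rfl⟩ := Nat.exists_eq_add_of_le' hm
    have := (hnext (DP (PiNat.res x n)) ((PiNat.res x n).length + 1) (x n)).2
    exact this.trans_eq (by rw [PiNat.res_length])
  have hdom : ∀ x, x ∈ (inducedMap D).1 := fun x => by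
    rw [hanti.map_of_vanishingDiam hdiam fun l => ?_]
    · exact mem_univ x
    · rw [nonempty_iff_ne_empty]
      intro h
      exact (DP l).2.2 (by simp [show (DP l).1 = ∅ from h])
  have hdisj' : CantorScheme.Disjoint fun l => g '' D l :=
    fun l => hdisj (DP l) (l.length + 1)
  have hdom' : ∀ x, x ∈ (inducedMap fun l => g '' D l).1 := fun x =>
    ⟨g ((inducedMap D).2 ⟨x, hdom x⟩),
      mem_iInter.2 fun n => mem_image_of_mem g (map_mem ⟨x, hdom x⟩ n)⟩
  refine ⟨fun x => (inducedMap fun l => g '' D l).2 ⟨x, hdom' x⟩, ?_, ?_⟩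
  · rintro _ ⟨x, rfl⟩
    exact image_subset_range g _ (map_mem ⟨x, hdom' x⟩ 0)
  · intro x y hxy
    simpa using hdisj'.map_injective hxy

open MeasureTheory Cardinal in
/-- Suslin's perfect set theorem, in terms of cardinalities. -/
theorem MeasureTheory.AnalyticSet.continuum_le_mk {α : Type} [TopologicalSpace α] [T2Space α]
    {s : Set α} (hs : AnalyticSet s) (hunc : ¬ s.Countable) : 𝔠 ≤ #s := by
  rw [AnalyticSet] at hs
  rcases hs with rfl | ⟨g, hg, rfl⟩
  · exact absurd countable_empty hunc
  let := TopologicalSpace.upgradeIsCompletelyMetrizable (ℕ → ℕ)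
  obtain ⟨f, hf, hinj⟩ := exists_nat_bool_injection_range_of_not_countable hg hunc
  have := Cardinal.mk_le_of_injective (f := fun x => (⟨f x, hf ⟨x, rfl⟩⟩ : range g))
    fun x y h => hinj (congrArg Subtype.val h)
  calc 𝔠 = #(ℕ → Bool) := by simp
    _ ≤ #(range g) := this

end PerfectSet

section Copies

open Set Filter Topology MeasureTheory
open Cardinal hiding univ

theorem chi_injective : Function.Injective chi := by
  intro A B h
  ext n
  simpa [chi] using congrFun h n

/-- The self-embeddings of a relational structure, as a set of functions. -/
def selfEmbeddings (L : FirstOrder.Language) (M : Type*) [L.Structure M] : Set (M → M) :=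
  {f | Function.Injective f ∧
    ∀ (n : ℕ) (r : L.Relations n) (x : Fin n → M),
      Language.Structure.RelMap r (f ∘ x) ↔ Language.Structure.RelMap r x}

theorem mem_copies_iff {L : FirstOrder.Language} [L.IsRelational] {M : Type*} [L.Structure M]
    {A : Set M} : A ∈ Copies L M ↔ ∃ f ∈ selfEmbeddings L M, range f = A := by
  constructor
  · rintro ⟨e⟩
    refine ⟨fun m => (e.symm m : M), ⟨?_, fun n r x => ?_⟩, ?_⟩
    · exact Subtype.val_injective.comp e.symm.injective
    · exact e.symm.map_rel r x
    · ext m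
      constructor
      · rintro ⟨k, rfl⟩
        exact (e.symm k).2
      · intro hm
        exact ⟨e ⟨m, hm⟩, by simp⟩
  · rintro ⟨f, ⟨hf, hr⟩, rfl⟩
    refine ⟨Language.Equiv.symm
      { toEquiv := Equiv.ofInjective f hf
        map_fun' := fun g => isEmptyElim g
        map_rel' := fun r x => hr _ r x }⟩

theorem iterate_mem_selfEmbeddings {L : FirstOrder.Language} {M : Type*} [L.Structure M]
    {f : M → M} (hf : f ∈ selfEmbeddings L M) (k : ℕ) : f^[k] ∈ selfEmbeddings L M := by
  refine ⟨hf.1.iterate k, fun n r x => ?_⟩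
  induction k with
  | zero => rfl
  | succ k ih => rw [Function.iterate_succ', Function.comp_assoc, hf.2, ih]

theorem univ_mem_copies (L : FirstOrder.Language) [L.IsRelational] (M : Type*) [L.Structure M] :
    univ ∈ Copies L M :=
  mem_copies_iff.2 ⟨id, ⟨Function.injective_id, fun _ _ _ => Iff.rfl⟩, range_id⟩

theorem strictAnti_range_iterate {M : Type*} {f : M → M} (hf : Function.Injective f)
    (hs : ¬ Function.Surjective f) : StrictAnti fun k => range f^[k] := by
  refine strictAnti_nat_of_succ_lt fun k => ?_
  have : range f^[k + 1] = f^[k] '' range f := by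
    rw [Function.iterate_succ, range_comp]
  change range f^[k + 1] ⊂ range f^[k]
  rw [this, ← image_univ (f := f^[k])]
  exact ((hf.iterate k).image_strictMono) (ssubset_univ_iff.2 fun h => hs (range_eq_univ.1 h))

theorem copies_infinite {L : FirstOrder.Language} [L.IsRelational] {M : Type*} [L.Structure M]
    (h : Copies L M ≠ {univ}) : (Copies L M).Infinite := by
  obtain ⟨A, hA, hAne⟩ : ∃ A ∈ Copies L M, A ≠ univ := by
    by_contra! hall
    exact h (eq_singleton_iff_unique_mem.2 ⟨univ_mem_copies L M, hall⟩)
  obtain ⟨f, hf, rfl⟩ := mem_copies_iff.1 hA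
  exact infinite_of_injective_forall_mem
    (strictAnti_range_iterate hf.1 fun hs => hAne hs.range_eq).injective
    fun k => mem_copies_iff.2 ⟨f^[k], iterate_mem_selfEmbeddings hf k, rfl⟩

theorem isClosed_selfEmbeddings (L : FirstOrder.Language) (M : Type*) [L.Structure M]
    [TopologicalSpace M] [DiscreteTopology M] : IsClosed (selfEmbeddings L M) := by
  have : selfEmbeddings L M = (⋂ (a : M) (b : M), {f | f a = f b → a = b}) ∩
      ⋂ (n : ℕ) (r : L.Relations n) (x : Fin n → M),
        {f | Language.Structure.RelMap r (f ∘ x) ↔ Language.Structure.RelMap r x} := by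
    ext f
    simp [selfEmbeddings, Function.Injective]
  rw [this]
  refine IsClosed.inter (isClosed_iInter fun a => isClosed_iInter fun b => ?_)
    (isClosed_iInter fun n => isClosed_iInter fun r => isClosed_iInter fun x => ?_)
  · have hc : Continuous fun f : M → M => (f a, f b) := by fun_prop
    exact (isClosed_discrete {p : M × M | p.1 = p.2 → a = b}).preimage hc
  · have hc : Continuous fun f : M → M => f ∘ x := by
      change Continuous fun (f : M → M) i => f (x i)
      fun_prop
    exact (isClosed_discrete
      {y : Fin n → M | Language.Structure.RelMap r y ↔ Language.Structure.RelMap r x}).preimage hc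

theorem measurable_chi_range_union :
    Measurable fun p : (ℕ → ℕ) × (ℕ → Bool) => chi (range p.1 ∪ {n | p.2 n = true}) := by
  refine measurable_pi_lambda _ fun n => measurable_to_bool ?_
  have : (fun p : (ℕ → ℕ) × (ℕ → Bool) => chi (range p.1 ∪ {n | p.2 n = true}) n) ⁻¹' {true} =
      (⋃ k, {p | p.1 k = n}) ∪ {p | p.2 n = true} := by
    ext p
    simp [chi]
  rw [this]
  refine MeasurableSet.union (MeasurableSet.iUnion fun k => ?_) ?_
  · exact measurableSet_eq_fun ((measurable_pi_apply k).comp measurable_fst) measurable_const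
  · exact measurableSet_eq_fun ((measurable_pi_apply n).comp measurable_snd) measurable_const

theorem analyticSet_chi_image_copies (L : FirstOrder.Language) [L.IsRelational] [L.Structure ℕ] :
    AnalyticSet (chi '' Copies L ℕ) := by
  have hm := ((isClosed_selfEmbeddings L ℕ).measurableSet.prod
    (measurableSet_singleton (fun _ : ℕ => false))).analyticSet_image measurable_chi_range_union
  convert hm using 1
  ext c
  simp [mem_copies_iff]

theorem analyticSet_chi_image_upperClosure_copies (L : FirstOrder.Language) [L.IsRelational]
    [L.Structure ℕ] : AnalyticSet (chi '' {B : Set ℕ | ∃ A ∈ Copies L ℕ, A ⊆ B}) := by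
  have hm := ((isClosed_selfEmbeddings L ℕ).measurableSet.prod
    (MeasurableSet.univ (α := ℕ → Bool))).analyticSet_image measurable_chi_range_union
  convert hm using 1
  ext c
  simp only [mem_copies_iff, mem_image, mem_ofPred_eq]
  constructor
  · rintro ⟨B, ⟨_, ⟨f, hf, rfl⟩, hfB⟩, rfl⟩
    refine ⟨(f, chi B), ⟨hf, mem_univ _⟩, congrArg chi ?_⟩
    simpa [chi] using hfB
  · rintro ⟨⟨f, y⟩, ⟨hf, -⟩, rfl⟩
    exact ⟨_, ⟨range f, ⟨f, hf, rfl⟩, subset_union_left⟩, rfl⟩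

theorem mk_set_nat_le_continuum (S : Set (Set ℕ)) : #S ≤ 𝔠 :=
  (mk_set_le S).trans (by simp)

theorem mk_copies (L : FirstOrder.Language) [L.IsRelational] [L.Structure ℕ] :
    #(Copies L ℕ) = 1 ∨ #(Copies L ℕ) = ℵ₀ ∨ #(Copies L ℕ) = 𝔠 := by
  by_cases h : Copies L ℕ = {univ}
  · exact Or.inl (by rw [h, mk_singleton])
  right
  by_cases hc : (Copies L ℕ).Countable
  · exact Or.inl (le_antisymm (le_aleph0_iff_set_countable.2 hc)
      (infinite_iff.1 (copies_infinite h).to_subtype))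
  · refine Or.inr (le_antisymm (mk_set_nat_le_continuum _) ?_)
    rw [← mk_image_eq chi_injective]
    exact (analyticSet_chi_image_copies L).continuum_le_mk
      fun h' => hc (countable_of_injective_of_countable_image chi_injective.injOn h')

theorem mk_upperClosure_eq_continuum {S : Set (Set ℕ)} {A : Set ℕ} (hA : A ∈ S)
    (hinf : Aᶜ.Infinite) : #{B : Set ℕ | ∃ A ∈ S, A ⊆ B} = 𝔠 := by
  refine le_antisymm (mk_set_nat_le_continuum _) ?_
  have hinj : Function.Injective fun C : Set ↥(Aᶜ) =>
      (⟨A ∪ Subtype.val '' C, A, hA, subset_union_left⟩ : {B : Set ℕ | ∃ A ∈ S, A ⊆ B}) := by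
    intro C D h
    have h' : A ∪ Subtype.val '' C = A ∪ Subtype.val '' D := congrArg Subtype.val h
    ext ⟨n, hn⟩
    have := Set.ext_iff.1 h' n
    simpa [show n ∉ A from hn] using this
  have : Infinite ↥(Aᶜ) := hinf.to_subtype
  calc 𝔠 = #(Set ↥(Aᶜ)) := by simp
    _ ≤ _ := mk_le_of_injective hinj

theorem mk_upperClosure_copies (L : FirstOrder.Language) [L.IsRelational] [L.Structure ℕ] :
    #{B : Set ℕ | ∃ A ∈ Copies L ℕ, A ⊆ B} = 1 ∨ #{B : Set ℕ | ∃ A ∈ Copies L ℕ, A ⊆ B} = ℵ₀ ∨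
      #{B : Set ℕ | ∃ A ∈ Copies L ℕ, A ⊆ B} = 𝔠 := by
  by_cases h : Copies L ℕ = {univ}
  · left
    have : {B : Set ℕ | ∃ A ∈ Copies L ℕ, A ⊆ B} = {univ} := by
      ext B
      simp [h, univ_subset_iff]
    rw [this, mk_singleton]
  right
  by_cases hc : ∃ A ∈ Copies L ℕ, Aᶜ.Infinite
  · obtain ⟨A, hA, hinf⟩ := hc
    exact Or.inr (mk_upperClosure_eq_continuum hA hinf)
  · left
    push Not at hc
    refine le_antisymm (le_aleph0_iff_set_countable.2 ?_) (infinite_iff.1 ?_)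
    · refine ((countable_ofPred_finite_subset (countable_univ (α := ℕ))).image compl).mono ?_
      rintro B ⟨A, hA, hAB⟩
      exact ⟨Bᶜ, ⟨(hc A hA).subset (compl_subset_compl.2 hAB), subset_univ _⟩, compl_compl B⟩
    · have hsub : Copies L ℕ ⊆ {B : Set ℕ | ∃ A ∈ Copies L ℕ, A ⊆ B} :=
        fun A hA => ⟨A, hA, Subset.rfl⟩
      exact ((copies_infinite h).mono hsub).to_subtype

end Copies

/-- For a relational structure with domain `ℕ`, the sets `χ[P(X)]` and `χ[P(X)↑]` have the Baire
property in the Cantor space, and each of `|P(X)|` and `|P(X)↑|` is `1`, `ℵ₀` or `2^ℵ₀`. -/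
theorem copies_baire_property_and_size (L : FirstOrder.Language) [L.IsRelational]
    [L.Structure ℕ] :
    (∃ U : Set (ℕ → Bool), IsOpen U ∧ IsMeagre (symmDiff U (chi '' Copies L ℕ))) ∧
    (∃ U : Set (ℕ → Bool), IsOpen U ∧
      IsMeagre (symmDiff U (chi '' {B : Set ℕ | ∃ A ∈ Copies L ℕ, A ⊆ B}))) ∧
    (Cardinal.mk (Copies L ℕ) = 1 ∨ Cardinal.mk (Copies L ℕ) = Cardinal.aleph0 ∨
      Cardinal.mk (Copies L ℕ) = Cardinal.continuum) ∧
    (Cardinal.mk {B : Set ℕ | ∃ A ∈ Copies L ℕ, A ⊆ B} = 1 ∨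
      Cardinal.mk {B : Set ℕ | ∃ A ∈ Copies L ℕ, A ⊆ B} = Cardinal.aleph0 ∨
      Cardinal.mk {B : Set ℕ | ∃ A ∈ Copies L ℕ, A ⊆ B} = Cardinal.continuum) := by
  exact ⟨(analyticSet_chi_image_copies L).exists_isOpen_isMeagre_symmDiff,
    (analyticSet_chi_image_upperClosure_copies L).exists_isOpen_isMeagre_symmDiff,
    mk_copies L, mk_upperClosure_copies L⟩
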